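/- (The helicoid data satisfies the crosscap criterion at every 1/k.) Let γ(t) := (cos t, sin t, t). Then: (i) γ'(t) = (−sin t, cos t, 1) is a nonzero null vector for the Lorentz inner product, for every t; (ii) D(γ₂₃', γ₂₃'')(t) = γ₂'(t)γ₃''(t) − γ₃'(t)γ₂''(t) = sin t; (iii) for every natural number k ≥ 1, sin(1/k) ≠ 0, so γ'(1/k) ≠ 0 and D(γ₂₃', γ₂₃'')(1/k) ≠ 0. Consequently, for every r > 0 and n ≥ 1 the singular Björling data {γ, L_n} with L_n(t) := γ'(t)·(1/(n(r+1)ⁿ))·∏_{i=1}^{n}(t − 1/i) satisfies at each t = 1/k (k = 1, …, n) the cuspidal crosscap criterion: γ' ≠ 0, L_n = 0, L_n' ≠ 0 and D(γ₂₃', γ₂₃'') ≠ 0. -/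

import Mathlib

/-- The Lorentz inner product on `ℝ³`: `⟨x,y⟩ = x₁y₁ + x₂y₂ − x₃y₃`. -/
def lprod (x y : Fin 3 → ℝ) : ℝ := x 0 * y 0 + x 1 * y 1 - x 2 * y 2

/-- A product `(t - a) • h t` with `h` continuous at `a` has derivative `h a` at `a`. -/
theorem hasDerivAt_sub_smul_of_continuousAt {E : Type*} [NormedAddCommGroup E] [NormedSpace ℝ E]
    {h : ℝ → E} {a : ℝ} (hh : ContinuousAt h a) :
    HasDerivAt (fun t => (t - a) • h t) (h a) a := by
  rw [hasDerivAt_iff_tendsto_slope]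
  refine (hh.tendsto.mono_left nhdsWithin_le_nhds).congr' ?_
  filter_upwards [self_mem_nhdsWithin] with t ht
  have ht' : t - a ≠ 0 := sub_ne_zero.2 ht
  simp [slope, smul_smul, ht']

theorem sin_one_div_natCast_ne_zero {k : ℕ} (hk : 1 ≤ k) : Real.sin (1 / (k : ℝ)) ≠ 0 := by
  have hk' : (1 : ℝ) ≤ k := by exact_mod_cast hk
  have hpos : 0 < 1 / (k : ℝ) := by positivity
  have hle : 1 / (k : ℝ) ≤ 1 := by rw [div_le_one (by linarith)]; exact hk'
  exact (Real.sin_pos_of_pos_of_lt_pi hpos (by linarith [Real.pi_gt_three])).ne'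

/-- The helicoid data satisfies the cuspidal crosscap criterion at every
`1/k`: for `γ(t) = (cos t, sin t, t)`, (i) `γ'(t) = (−sin t, cos t, 1)` is a nonzero null
vector for every `t`; (ii) `D(γ₂₃',γ₂₃'')(t) = sin t`; (iii) `sin(1/k) ≠ 0` for every
`k ≥ 1`. Consequently, for every `r > 0` and `n ≥ 1`, the data `{γ, Lₙ}` with
`Lₙ(t) = γ'(t)·(1/(n(r+1)ⁿ))·∏_{i=1}^{n}(t − 1/i)` satisfies at each `t = 1/k`
(`1 ≤ k ≤ n`) the criterion `γ' ≠ 0`, `Lₙ = 0`, `Lₙ' ≠ 0`, `D ≠ 0`. -/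
theorem stmt_19 (γ G : ℝ → (Fin 3 → ℝ))
    (hγdef : ∀ t : ℝ, γ t = ![Real.cos t, Real.sin t, t])
    (hGdef : ∀ t : ℝ, G t = ![-Real.sin t, Real.cos t, 1]) :
    (∀ t : ℝ, HasDerivAt γ (G t) t ∧ G t ≠ 0 ∧ lprod (G t) (G t) = 0) ∧
    (∀ t : ℝ, G t 1 * deriv (fun s => G s 2) t - G t 2 * deriv (fun s => G s 1) t
        = Real.sin t) ∧
    (∀ k : ℕ, 1 ≤ k → Real.sin (1 / (k : ℝ)) ≠ 0 ∧ G (1 / (k : ℝ)) ≠ 0) ∧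
    (∀ r : ℝ, 0 < r → ∀ n : ℕ, 1 ≤ n →
      ∀ Ln : ℝ → (Fin 3 → ℝ),
      (∀ t : ℝ, Ln t =
        ((1 : ℝ) / ((n : ℝ) * (r + 1) ^ n) *
          ∏ i ∈ Finset.Icc 1 n, (t - 1 / (i : ℝ))) • G t) →
      ∀ k ∈ Finset.Icc 1 n,
        G (1 / (k : ℝ)) ≠ 0 ∧
        Ln (1 / (k : ℝ)) = 0 ∧
        (∃ V : Fin 3 → ℝ, HasDerivAt Ln V (1 / (k : ℝ)) ∧ V ≠ 0) ∧
        Real.sin (1 / (k : ℝ)) ≠ 0) := by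
  obtain rfl : G = fun t => ![-Real.sin t, Real.cos t, 1] := funext hGdef
  obtain rfl : γ = fun t => ![Real.cos t, Real.sin t, t] := funext hγdef
  have hG0 : ∀ t : ℝ, ![-Real.sin t, Real.cos t, 1] ≠ 0 := fun t h => by
    simpa using congrFun h 2
  have hGc : Continuous fun t : ℝ => ![-Real.sin t, Real.cos t, 1] := by
    rw [continuous_pi_iff]
    intro i
    fin_cases i <;> simp <;> fun_prop
  refine ⟨fun t => ⟨?_, hG0 t, ?_⟩, fun t => ?_,
    fun k hk => ⟨sin_one_div_natCast_ne_zero hk, hG0 _⟩, ?_⟩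
  · rw [hasDerivAt_pi]
    intro i
    fin_cases i
    · simpa using Real.hasDerivAt_cos t
    · simpa using Real.hasDerivAt_sin t
    · simpa using hasDerivAt_id' t
  · simp [lprod]
    linarith [Real.sin_sq_add_cos_sq t]
  · simp
  · intro r hr n hn Ln hLn k hk
    have hk1 : 1 ≤ k := (Finset.mem_Icc.1 hk).1
    set c : ℝ := 1 / ((n : ℝ) * (r + 1) ^ n)
    have hc0 : c ≠ 0 := by
      have : (0 : ℝ) < n := by exact_mod_cast hn
      positivity
    set q : ℝ → ℝ := fun t => c * ∏ i ∈ (Finset.Icc 1 n).erase k, (t - 1 / (i : ℝ)) with hq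
    have hLn' : Ln = fun t => (t - 1 / (k : ℝ)) • q t • ![-Real.sin t, Real.cos t, 1] := by
      funext t
      rw [hLn, ← Finset.mul_prod_erase _ _ hk, smul_smul]
      congr 1
      simp only [hq]
      ring
    have hqc : Continuous q := by fun_prop
    have hq0 : q (1 / (k : ℝ)) ≠ 0 := by
      refine mul_ne_zero hc0 (Finset.prod_ne_zero_iff.2 fun i hi h => ?_)
      have hik : (k : ℝ) = i := by
        simpa using sub_eq_zero.1 h
      exact (Finset.mem_erase.1 hi).1 (by exact_mod_cast hik.symm)
    refine ⟨hG0 _, by simp [hLn'], ⟨_, ?_, smul_ne_zero hq0 (hG0 (1 / (k : ℝ)))⟩,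
      sin_one_div_natCast_ne_zero hk1⟩
    rw [hLn']
    exact hasDerivAt_sub_smul_of_continuousAt (hqc.smul hGc).continuousAt
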